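/- arXiv:1406.5722 — 7 statements merged into one kernel-verified Lean document; each statement's English description precedes it below -/
import Mathlib

section
/- For every integer n ≥ 1, the price of envy-freeness with n agents and n items satisfies p_envy(n,n) ≥ (1/2)·√n − 1/2. -/
open Finset

/-- A utility matrix for `n` agents and `n` items: `x i j` is the (nonnegative)
utility of agent `j` for item `i`, and each agent's utilities sum to `1`. -/
def IsUtilMatrix (n : ℕ) (x : Fin n → Fin n → ℝ) : Prop :=
  (∀ i j, 0 ≤ x i j) ∧ (∀ j, ∑ i, x i j = 1)

/-- `x` is diagonally envy-free: the allocation assigning item `j` to agent `j`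
is envy-free, i.e. `x j j ≥ x i j` for all `i, j`. -/
def DiagEnvyFree (n : ℕ) (x : Fin n → Fin n → ℝ) : Prop :=
  ∀ i j, x j j ≥ x i j

/-- Optimal welfare: each item goes to an agent valuing it the most. -/
noncomputable def uStar (n : ℕ) (x : Fin n → Fin n → ℝ) : ℝ :=
  ∑ i, ⨆ j, x i j

/-- Welfare of the (envy-free) diagonal allocation. -/
noncomputable def uStarF (n : ℕ) (x : Fin n → Fin n → ℝ) : ℝ :=
  ∑ j, x j j

/-- The price of envy-freeness for `n` agents and `n` items: the supremum of
`uStar x / uStarF x` over all diagonally envy-free utility matrices `x`. -/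
noncomputable def pEnvySq (n : ℕ) : ℝ :=
  sSup {r : ℝ | ∃ x : Fin n → Fin n → ℝ,
    IsUtilMatrix n x ∧ DiagEnvyFree n x ∧ r = uStar n x / uStarF n x}

/-- Summing a constant over the indices below `k * m` in one residue class modulo `k`. -/
lemma sum_range_mul_ite_mod_eq {k j : ℕ} (hj : j < k) (m : ℕ) (c : ℝ) :
    ∑ i ∈ range (k * m), (if i % k = j then c else 0) = m * c := by
  induction m with
  | zero => simp
  | succ m ih =>
    have h : ∑ i ∈ range k, (if (k * m + i) % k = j then c else 0) = c := by
      rw [Finset.sum_congr rfl (g := fun i => if i = j then c else 0)]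
      · simp [hj]
      · intro i hi
        rw [Nat.mul_add_mod, Nat.mod_eq_of_lt (Finset.mem_range.1 hi)]
    rw [Nat.mul_succ, Finset.sum_range_add, ih, h]
    push_cast
    ring

/-- A sum over `Fin n` supported on the indices below `m ≤ n`. -/
lemma sum_fin_ite_lt {n m : ℕ} (hm : m ≤ n) (f : ℕ → ℝ) :
    ∑ i : Fin n, (if (i : ℕ) < m then f i else 0) = ∑ i ∈ range m, f i := by
  rw [Fin.sum_univ_eq_sum_range (fun i => if i < m then f i else 0) n, ← Finset.sum_filter]
  congr 1
  ext i
  simp only [Finset.mem_filter, Finset.mem_range]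
  omega

/-- In a diagonally envy-free utility matrix the diagonal welfare is at least `1`. -/
lemma one_le_uStarF {n : ℕ} (hn : 1 ≤ n) {x : Fin n → Fin n → ℝ}
    (hx : IsUtilMatrix n x) (hd : DiagEnvyFree n x) : 1 ≤ uStarF n x := by
  have hn' : (0 : ℝ) < n := by exact_mod_cast hn
  have h : ∀ j, (1 : ℝ) / n ≤ x j j := fun j => by
    have h₁ : ∑ i, x i j ≤ ∑ _i : Fin n, x j j := Finset.sum_le_sum fun i _ => hd i j
    rw [hx.2 j] at h₁
    rw [div_le_iff₀ hn']
    simpa [mul_comm] using h₁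
  calc (1 : ℝ) = ∑ _j : Fin n, (1 : ℝ) / n := by simp [hn'.ne']
    _ ≤ uStarF n x := Finset.sum_le_sum fun j _ => h j

/-- The optimal welfare is at most the number of items. -/
lemma uStar_le {n : ℕ} (hn : 1 ≤ n) {x : Fin n → Fin n → ℝ}
    (hx : IsUtilMatrix n x) : uStar n x ≤ n := by
  have : Nonempty (Fin n) := ⟨⟨0, hn⟩⟩
  calc uStar n x ≤ ∑ _i : Fin n, (1 : ℝ) := by
        refine Finset.sum_le_sum fun i _ => ciSup_le fun j => ?_
        rw [← hx.2 j]
        exact Finset.single_le_sum (f := fun i => x i j) (fun i _ => hx.1 i j)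
          (Finset.mem_univ i)
    _ = n := by simp

/-- The price of envy-freeness is an upper bound of the ratios it is the supremum of. -/
lemma div_le_pEnvySq {n : ℕ} (hn : 1 ≤ n) {x : Fin n → Fin n → ℝ}
    (hx : IsUtilMatrix n x) (hd : DiagEnvyFree n x) :
    uStar n x / uStarF n x ≤ pEnvySq n := by
  refine le_csSup ⟨n, ?_⟩ ⟨x, hx, hd, rfl⟩
  rintro r ⟨y, hy, hyd, rfl⟩
  have h₁ := one_le_uStarF hn hy hyd
  exact div_le_of_le_mul₀ (zero_le_one.trans h₁) n.cast_nonneg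
    ((uStar_le hn hy).trans (le_mul_of_one_le_right n.cast_nonneg h₁))

/-- Each agent `j < k` spreads its utility evenly over the `k` items `i < k * k` with
`i ≡ j [MOD k]`; every other agent is indifferent between all items. -/
noncomputable def blockUtil (n k : ℕ) (i j : Fin n) : ℝ :=
  if (j : ℕ) < k then
    (if (i : ℕ) < k * k then (if (i : ℕ) % k = j then 1 / (k : ℝ) else 0) else 0)
  else 1 / n

lemma blockUtil_nonneg (n k : ℕ) (i j : Fin n) : 0 ≤ blockUtil n k i j := by
  unfold blockUtil
  split_ifs <;> positivity

lemma isUtilMatrix_blockUtil {n k : ℕ} (hn : 1 ≤ n) (hk : 1 ≤ k) (hkn : k * k ≤ n) :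
    IsUtilMatrix n (blockUtil n k) := by
  have hn' : (n : ℝ) ≠ 0 := by positivity
  have hk' : (k : ℝ) ≠ 0 := by positivity
  refine ⟨blockUtil_nonneg n k, fun j => ?_⟩
  by_cases hj : (j : ℕ) < k
  · simp only [blockUtil, hj, if_true]
    rw [sum_fin_ite_lt hkn (fun i => if i % k = j then 1 / (k : ℝ) else 0),
      sum_range_mul_ite_mod_eq hj]
    field_simp
  · simp [blockUtil, hj, hn']

lemma blockUtil_self {n k : ℕ} (j : Fin n) :
    blockUtil n k j j = if (j : ℕ) < k then 1 / (k : ℝ) else 1 / n := by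
  unfold blockUtil
  split_ifs with h₁ h₂ h₃
  · rfl
  · exact absurd (Nat.mod_eq_of_lt h₁) h₃
  · exact absurd (by nlinarith) h₂
  · rfl

lemma diagEnvyFree_blockUtil (n k : ℕ) : DiagEnvyFree n (blockUtil n k) := by
  intro i j
  rw [blockUtil_self, blockUtil]
  split_ifs <;> first | exact le_rfl | positivity

lemma le_uStar_blockUtil {n k : ℕ} (hk : 1 ≤ k) (hkn : k * k ≤ n) :
    (k : ℝ) ≤ uStar n (blockUtil n k) := by
  have hk' : (k : ℝ) ≠ 0 := by positivity
  calc (k : ℝ) = ∑ i : Fin n, (if (i : ℕ) < k * k then 1 / (k : ℝ) else 0) := by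
        rw [sum_fin_ite_lt hkn (fun _ => 1 / (k : ℝ))]
        simp [hk']
    _ ≤ uStar n (blockUtil n k) := by
        refine Finset.sum_le_sum fun i _ => ?_
        split_ifs with hi
        · have hlt : (i : ℕ) % k < k := Nat.mod_lt _ hk
          refine le_ciSup_of_le (Set.finite_range _).bddAbove
            ⟨(i : ℕ) % k, hlt.trans_le (by nlinarith)⟩ ?_
          simp [blockUtil, hlt, hi]
        · exact Real.iSup_nonneg fun j => blockUtil_nonneg n k i j

lemma uStarF_blockUtil_le {n k : ℕ} (hn : 1 ≤ n) (hk : 1 ≤ k) (hkn : k ≤ n) :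
    uStarF n (blockUtil n k) ≤ 2 := by
  have hn' : (n : ℝ) ≠ 0 := by positivity
  have hk' : (k : ℝ) ≠ 0 := by positivity
  calc uStarF n (blockUtil n k)
      ≤ ∑ j : Fin n, ((if (j : ℕ) < k then 1 / (k : ℝ) else 0) + 1 / n) := by
        refine Finset.sum_le_sum fun j _ => ?_
        rw [blockUtil_self]
        split_ifs
        · exact le_add_of_nonneg_right (by positivity)
        · simp
    _ = 2 := by
        rw [Finset.sum_add_distrib, sum_fin_ite_lt hkn (fun _ => 1 / (k : ℝ))]
        simp [hk', hn']
        norm_num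

/-- For every integer `n ≥ 1`, the price of envy-freeness with `n` agents and
`n` items satisfies `p_envy(n,n) ≥ (1/2)·√n − 1/2`. -/
theorem pEnvySq_ge (n : ℕ) (hn : 1 ≤ n) :
    pEnvySq n ≥ (1 / 2) * Real.sqrt n - 1 / 2 := by
  set k := Nat.sqrt n
  have hk : 1 ≤ k := Nat.le_sqrt.2 (by simpa using hn)
  have hkn : k * k ≤ n := Nat.sqrt_le n
  have hx := isUtilMatrix_blockUtil hn hk hkn
  have hd := diagEnvyFree_blockUtil n k
  have hF := one_le_uStarF hn hx hd
  have hF' := uStarF_blockUtil_le hn hk ((Nat.le_mul_self k).trans hkn)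
  have hsqrt : Real.sqrt n ≤ k + 1 := Real.sqrt_le_iff.2 ⟨by positivity, by
    exact_mod_cast (Nat.lt_succ_sqrt' n).le⟩
  calc (1 / 2) * Real.sqrt n - 1 / 2 ≤ k / 2 := by linarith
    _ ≤ uStar n (blockUtil n k) / uStarF n (blockUtil n k) :=
        div_le_div₀ (k.cast_nonneg.trans (le_uStar_blockUtil hk hkn))
          (le_uStar_blockUtil hk hkn) (by linarith) hF'
    _ ≤ pEnvySq n := div_le_pEnvySq hn hx hd
end

section
/- There exists a constant C > 0 such that for every integer n ≥ 1 one has |p_envy(n,n) − (1/2)·√n| ≤ C; that is, p_envy(n,n) = (1/2)·√n + Θ(1). -/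
open Finset

lemma two_mul_mul_le_of_le_mul {k m u t : ℝ} (hk : 0 ≤ k) (hm : 0 ≤ m) (hu : 0 ≤ u)
    (h : u ≤ k * m) : 2 * t * u ≤ t ^ 2 * k + u * m := by
  refine le_of_abs_le (abs_le_of_sq_le_sq ?_ (by positivity))
  nlinarith [sq_nonneg (t ^ 2 * k - u * m),
    mul_le_mul_of_nonneg_left h (mul_nonneg (sq_nonneg t) hu)]

lemma one_div_le_diag {n : ℕ} (hn : 1 ≤ n) {x : Fin n → Fin n → ℝ} (hx : IsUtilMatrix n x)
    (hd : DiagEnvyFree n x) (j : Fin n) : 1 / (n : ℝ) ≤ x j j := by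
  have hn' : (0 : ℝ) < n := by exact_mod_cast hn
  have h : ∑ i, x i j ≤ ∑ _i : Fin n, x j j := sum_le_sum fun i _ => hd i j
  rw [hx.2 j, sum_const, card_univ, Fintype.card_fin, nsmul_eq_mul] at h
  rwa [div_le_iff₀ hn', mul_comm]

lemma one_add_sq_div_le {n : ℕ} (hn : 1 ≤ n) {x : Fin n → Fin n → ℝ} (hx : IsUtilMatrix n x)
    (hd : DiagEnvyFree n x) :
    1 + uStar n x ^ 2 / n ≤ uStarF n x + uStar n x / n := by
  have hn' : (0 : ℝ) < n := by exact_mod_cast hn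
  have : Nonempty (Fin n) := ⟨⟨0, hn⟩⟩
  choose f hf using fun i => exists_eq_ciSup_of_finite (f := fun j => x i j)
  set u : Fin n → ℝ := fun j => ∑ i with f i = j, x i j
  set k : Fin n → ℝ := fun j => (#{i | f i = j} : ℝ)
  set t : ℝ := uStar n x / n with ht
  have hsum : uStar n x = ∑ j, u j := by
    rw [uStar, ← sum_fiberwise univ f]
    refine sum_congr rfl fun j _ => sum_congr rfl fun i hi => ?_
    rw [← hf i, (mem_filter.1 hi).2]
  have hcard : ∑ j, k j = n := by
    have h := card_eq_sum_card_fiberwise (f := f) (s := univ) (t := univ) (by simp)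
    rw [card_univ, Fintype.card_fin] at h
    simp only [k]
    exact_mod_cast h.symm
  have hpt (j : Fin n) : 1 / (n : ℝ) + 2 * t * u j ≤ x j j + t ^ 2 * k j + u j / n := by
    have hm := one_div_le_diag hn hx hd j
    have hu0 : 0 ≤ u j := sum_nonneg fun i _ => hx.1 i j
    have hu1 : u j ≤ 1 := by
      rw [← hx.2 j]
      exact sum_le_sum_of_subset_of_nonneg (filter_subset _ _) fun i _ _ => hx.1 i j
    have huk : u j ≤ k j * x j j := by
      simpa [u, k] using sum_le_card_nsmul {i | f i = j} (fun i => x i j) (x j j)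
        fun i _ => hd i j
    have h := two_mul_mul_le_of_le_mul (t := t) (Nat.cast_nonneg _) (hx.1 j j) hu0 huk
    have h' := mul_le_mul_of_nonneg_left hm (sub_nonneg.2 hu1)
    have : u j / n = u j * (1 / n) := by ring
    linarith
  have h := sum_le_sum fun j (_ : j ∈ univ) => hpt j
  simp only [sum_add_distrib, ← mul_sum, ← sum_div, ← hsum, hcard] at h
  have h1 : t ^ 2 * n = uStar n x ^ 2 / n := by rw [ht]; field_simp
  have h2 : 2 * t * uStar n x = 2 * (uStar n x ^ 2 / n) := by rw [ht]; ring
  have h3 : (∑ _j : Fin n, (1 : ℝ)) / n = 1 := by simp [hn'.ne']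
  have h4 : uStarF n x = ∑ j, x j j := rfl
  linarith

lemma uStar_div_uStarF_le {n : ℕ} (hn : 1 ≤ n) {x : Fin n → Fin n → ℝ}
    (hx : IsUtilMatrix n x) (hd : DiagEnvyFree n x) :
    uStar n x / uStarF n x ≤ (1 / 2) * √n + 1 := by
  have hW := one_le_uStarF hn hx hd
  have hn' : (0 : ℝ) < n := by exact_mod_cast hn
  have h := one_add_sq_div_le hn hx hd
  rw [div_le_iff₀ (by linarith)]
  set U := uStar n x
  set W := uStarF n x
  have hr : 1 ≤ √(n : ℝ) := Real.one_le_sqrt.2 (by exact_mod_cast hn)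
  have hsq : (n : ℝ) = √(n : ℝ) ^ 2 := (Real.sq_sqrt hn'.le).symm
  set r := √(n : ℝ)
  have hr0 : 0 < r := by linarith
  have h' : r ^ 2 + U ^ 2 ≤ W * r ^ 2 + U := by
    rw [hsq] at h
    field_simp at h
    linarith
  have hU : U * (2 * r - 1) ≤ W * r ^ 2 := by nlinarith [sq_nonneg (r - U)]
  have hr2 : r ^ 2 ≤ (1 / 2 * r + 1) * (2 * r - 1) := by nlinarith
  have hWr := mul_le_mul_of_nonneg_left hr2 (by linarith : 0 ≤ W)
  refine le_of_mul_le_mul_right ?_ (by linarith : 0 < 2 * r - 1)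
  linarith

lemma card_filter_mod_eq {s a : ℕ} (ha : a < s) :
    #{i ∈ range (s * s) | i % s = a} = s := by
  have hs : 0 < s := by omega
  conv_rhs => rw [← card_range s]
  refine card_nbij' (fun i => i / s) (fun q => a + s * q) ?_ ?_ ?_ ?_
  · intro i hi
    simp only [coe_filter, mem_range, Set.mem_ofPred_eq, coe_range, Set.mem_Iio] at hi ⊢
    exact Nat.div_lt_of_lt_mul hi.1
  · intro q hq
    simp only [coe_filter, mem_range, Set.mem_ofPred_eq, coe_range, Set.mem_Iio] at hq ⊢
    refine ⟨?_, by rw [Nat.add_mul_mod_self_left, Nat.mod_eq_of_lt ha]⟩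
    nlinarith
  · intro i hi
    simp only [coe_filter, mem_range, Set.mem_ofPred_eq] at hi
    have := Nat.mod_add_div i s
    simp only
    omega
  · intro q _
    simp [Nat.add_mul_div_left _ _ hs, Nat.div_eq_of_lt ha]

lemma sum_ite_val_lt {n k : ℕ} (hk : k ≤ n) (p : ℕ → Prop) [DecidablePred p] (c : ℝ) :
    ∑ i : Fin n, (if (i : ℕ) < k ∧ p i then c else 0) = #{i ∈ range k | p i} * c := by
  rw [Fin.sum_univ_eq_sum_range (fun i => if i < k ∧ p i then c else 0) n, ← sum_filter,
    sum_const, nsmul_eq_mul]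
  congr 3
  ext i
  simp only [mem_filter, mem_range]
  constructor
  · exact And.right
  · exact fun h => ⟨by omega, h⟩

/-- With `s = ⌊√n⌋`, each of the first `s` agents spreads its utility evenly over its own block
of `s` items, and every other agent is indifferent between all items. -/
noncomputable def blockUtility (n : ℕ) (i j : Fin n) : ℝ :=
  if (j : ℕ) < n.sqrt then
    if (i : ℕ) < n.sqrt * n.sqrt ∧ (i : ℕ) % n.sqrt = j then 1 / (n.sqrt : ℝ) else 0
  else 1 / (n : ℝ)

lemma isUtilMatrix_blockUtility {n : ℕ} (hn : 1 ≤ n) : IsUtilMatrix n (blockUtility n) := by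
  refine ⟨fun i j => ?_, fun j => ?_⟩
  · unfold blockUtility
    split_ifs <;> positivity
  · have hn' : (n : ℝ) ≠ 0 := by positivity
    by_cases hj : (j : ℕ) < n.sqrt
    · have hs : (n.sqrt : ℝ) ≠ 0 := by
        have : n.sqrt ≠ 0 := by omega
        exact_mod_cast this
      simp only [blockUtility, if_pos hj]
      rw [sum_ite_val_lt (Nat.sqrt_le n) (fun i => i % n.sqrt = j), card_filter_mod_eq hj,
        mul_one_div_cancel hs]
    · simp [blockUtility, hj, hn']

lemma blockUtility_diag {n : ℕ} (j : Fin n) :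
    blockUtility n j j = if (j : ℕ) < n.sqrt then 1 / (n.sqrt : ℝ) else 1 / (n : ℝ) := by
  unfold blockUtility
  split_ifs with h h' <;> try rfl
  exact absurd ⟨by nlinarith, Nat.mod_eq_of_lt h⟩ h'

lemma diagEnvyFree_blockUtility (n : ℕ) : DiagEnvyFree n (blockUtility n) := by
  intro i j
  rw [blockUtility_diag]
  unfold blockUtility
  split_ifs
  · exact le_rfl
  · positivity
  · exact le_rfl

lemma uStarF_blockUtility_le {n : ℕ} (hn : 1 ≤ n) : uStarF n (blockUtility n) ≤ 2 := by
  have hn' : (n : ℝ) ≠ 0 := by positivity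
  have hs : (n.sqrt : ℝ) ≠ 0 := by
    have := Nat.sqrt_pos.2 hn
    positivity
  calc uStarF n (blockUtility n)
      ≤ ∑ j : Fin n, ((if (j : ℕ) < n.sqrt ∧ True then 1 / (n.sqrt : ℝ) else 0) + 1 / n) := by
        refine sum_le_sum fun j _ => ?_
        rw [blockUtility_diag]
        simp only [and_true]
        split_ifs
        · exact le_add_of_nonneg_right (by positivity)
        · simp
    _ = 2 := by
        rw [sum_add_distrib, sum_ite_val_lt (Nat.sqrt_le_self n) fun _ => True]
        simp [hn', hs]
        norm_num

lemma sqrt_le_uStar_blockUtility {n : ℕ} (hn : 1 ≤ n) :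
    (n.sqrt : ℝ) ≤ uStar n (blockUtility n) := by
  have hpos := Nat.sqrt_pos.2 hn
  have hs : (n.sqrt : ℝ) ≠ 0 := by positivity
  calc (n.sqrt : ℝ)
      = ∑ i : Fin n, (if (i : ℕ) < n.sqrt * n.sqrt ∧ True then 1 / (n.sqrt : ℝ) else 0) := by
        rw [sum_ite_val_lt (Nat.sqrt_le n) fun _ => True]
        simp [hs]
    _ ≤ uStar n (blockUtility n) := by
        refine sum_le_sum fun i _ => ?_
        have hmod := Nat.mod_lt (i : ℕ) hpos
        let j : Fin n := ⟨i % n.sqrt, hmod.trans_le (Nat.sqrt_le_self n)⟩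
        refine le_trans (le_of_eq ?_)
          (le_ciSup (Set.finite_range fun j => blockUtility n i j).bddAbove j)
        simp [blockUtility, j, hmod]

/-- There exists a constant `C > 0` such that for every integer `n ≥ 1` one has
`|p_envy(n,n) − (1/2)·√n| ≤ C`, i.e. `p_envy(n,n) = (1/2)·√n + Θ(1)`. -/
theorem pEnvySq_asymptotics :
    ∃ C : ℝ, 0 < C ∧ ∀ n : ℕ, 1 ≤ n →
      |pEnvySq n - (1 / 2) * Real.sqrt n| ≤ C := by
  refine ⟨1, one_pos, fun n hn => abs_le.2 ⟨?_, ?_⟩⟩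
  · have hx := isUtilMatrix_blockUtility hn
    have hd := diagEnvyFree_blockUtility n
    have hle : uStar n (blockUtility n) / uStarF n (blockUtility n) ≤ pEnvySq n := by
      refine le_csSup ⟨(1 / 2) * √n + 1, ?_⟩ ⟨_, hx, hd, rfl⟩
      rintro r ⟨x, hx, hd, rfl⟩
      exact uStar_div_uStarF_le hn hx hd
    have hW := one_le_uStarF hn hx hd
    have hdiv : (n.sqrt : ℝ) / 2 ≤ uStar n (blockUtility n) / uStarF n (blockUtility n) :=
      div_le_div₀ ((Nat.cast_nonneg _).trans (sqrt_le_uStar_blockUtility hn))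
        (sqrt_le_uStar_blockUtility hn) (by linarith) (uStarF_blockUtility_le hn)
    have := Real.real_sqrt_lt_nat_sqrt_succ (a := n)
    linarith
  · have : pEnvySq n ≤ (1 / 2) * √n + 1 := by
      refine Real.sSup_le ?_ (by positivity)
      rintro r ⟨x, hx, hd, rfl⟩
      exact uStar_div_uStarF_le hn hx hd
    linarith
end

section
/- Let x be a diagonally envy-free utility matrix with u*_f(x) > 0 whose ratio attains the price of envy-freeness, u*(x)/u*_f(x) = p_envy(n,n), and let τ : {1,...,n} → {1,...,n} be an optimal assignment, i.e., ∑_{i=1}^n x(i,τ(i)) = u*(x), and suppose τ(j) = j for the agent j. Then x(i,j) = x(j,j) for every item i with τ(i) = j. -/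
open Finset

theorem sum_le_uStar {n : ℕ} (x : Fin n → Fin n → ℝ) (τ : Fin n → Fin n) :
    ∑ i, x i (τ i) ≤ uStar n x :=
  sum_le_sum fun i _ => le_ciSup (Set.finite_range fun j => x i j).bddAbove (τ i)

theorem uStar_le_mul_uStarF {n : ℕ} {x : Fin n → Fin n → ℝ} (hx : IsUtilMatrix n x)
    (hef : DiagEnvyFree n x) : uStar n x ≤ n * uStarF n x := by
  have h : ∀ i ∈ (univ : Finset (Fin n)), ⨆ j, x i j ≤ uStarF n x := fun i _ =>
    haveI : Nonempty (Fin n) := ⟨i⟩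
    ciSup_le fun j => (hef i j).trans
      (single_le_sum (f := fun l => x l l) (fun l _ => hx.1 l l) (mem_univ j))
  simpa [uStar] using sum_le_card_nsmul _ _ _ h

theorem uStar_div_uStarF_le_pEnvySq {n : ℕ} {x : Fin n → Fin n → ℝ} (hx : IsUtilMatrix n x)
    (hef : DiagEnvyFree n x) : uStar n x / uStarF n x ≤ pEnvySq n := by
  refine le_csSup ⟨n, ?_⟩ ⟨x, hx, hef, rfl⟩
  rintro _ ⟨y, hy, hyf, rfl⟩
  exact div_le_of_le_mul₀ (sum_nonneg fun l _ => hy.1 l l) n.cast_nonneg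
    (uStar_le_mul_uStarF hy hyf)

/-- A probability vector bounded by `v` and equal to `v` on the nonempty set `B` exists as soon as
`v` lies between `1 / n` and `1 / #B`. -/
theorem exists_sum_eq_one_eq_on {n : ℕ} (B : Finset (Fin n)) {v : ℝ}
    (hn : 1 ≤ n * v) (hB : #B * v ≤ 1) :
    ∃ c : Fin n → ℝ, (∀ i, 0 ≤ c i) ∧ (∀ i, c i ≤ v) ∧ ∑ i, c i = 1 ∧ ∀ i ∈ B, c i = v := by
  have hv : 0 ≤ v := by
    by_contra! h
    nlinarith [n.cast_nonneg (α := ℝ)]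
  have hcard : (#B : ℝ) + #Bᶜ = n := by
    exact_mod_cast (card_add_card_compl B).trans (Fintype.card_fin n)
  refine ⟨fun i => if i ∈ B then v else (1 - #B * v) / #Bᶜ, fun i => ?_, fun i => ?_, ?_,
    fun i hi => if_pos hi⟩
  · dsimp only
    split_ifs
    exacts [hv, div_nonneg (by linarith) (Nat.cast_nonneg _)]
  · dsimp only
    split_ifs
    · exact le_rfl
    · exact div_le_of_le_mul₀ (Nat.cast_nonneg _) hv (by nlinarith)
  · rw [← sum_add_sum_compl B, sum_congr rfl fun i hi => if_pos hi,
      sum_congr rfl fun i hi => if_neg (mem_compl.1 hi)]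
    simp only [sum_const, nsmul_eq_mul]
    rcases eq_or_ne (#Bᶜ : ℝ) 0 with h | h
    · rw [h, zero_mul, add_zero]
      rw [h, add_zero] at hcard
      exact le_antisymm hB (hcard ▸ hn)
    · field_simp
      ring

/-- Replacing the utilities of one agent `j` cannot increase the gain of `j` over its bundle in an
optimal assignment by more than the price of envy-freeness times the diagonal change. -/
theorem bundle_sum_sub_le_pEnvySq_mul {n : ℕ} {x : Fin n → Fin n → ℝ} (hx : IsUtilMatrix n x)
    (hef : DiagEnvyFree n x) (hpos : 0 < uStarF n x)
    (hopt : uStar n x / uStarF n x = pEnvySq n)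
    {τ : Fin n → Fin n} (hτ : ∑ i, x i (τ i) = uStar n x) (j : Fin n)
    {c : Fin n → ℝ} (hc : ∀ i, 0 ≤ c i) (hcj : ∀ i, c i ≤ c j) (hsum : ∑ i, c i = 1) :
    ∑ i with τ i = j, c i - ∑ i with τ i = j, x i j ≤ pEnvySq n * (c j - x j j) := by
  set y : Fin n → Fin n → ℝ := fun i => Function.update (x i) j (c i) with hy
  have hyj : ∀ i, y i j = c i := fun i => Function.update_self ..
  have hyne : ∀ i l, l ≠ j → y i l = x i l := fun i l h => Function.update_of_ne h ..
  have hyu : IsUtilMatrix n y := by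
    refine ⟨fun i l => ?_, fun l => ?_⟩ <;> rcases eq_or_ne l j with rfl | h
    · simpa only [hyj] using hc i
    · simpa only [hyne _ _ h] using hx.1 i l
    · simpa only [hyj] using hsum
    · simpa only [hyne _ _ h] using hx.2 l
  have hyf : DiagEnvyFree n y := by
    intro i l
    rcases eq_or_ne l j with rfl | h
    · simpa only [hyj] using hcj i
    · simpa only [hyne _ _ h] using hef i l
  have hcpos : 0 < c j := by
    by_contra! h
    linarith [sum_nonpos fun i (_ : i ∈ univ) => (hcj i).trans h]
  have hF : uStarF n y = uStarF n x + (c j - x j j) := by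
    rw [← sub_eq_iff_eq_add', uStarF, uStarF, ← sum_sub_distrib,
      sum_eq_single_of_mem j (mem_univ j) fun l _ h => by rw [hyne _ _ h, sub_self], hyj]
  have hFpos : 0 < uStarF n y :=
    hcpos.trans_le ((hyj j).ge.trans
      (single_le_sum (f := fun l => y l l) (fun l _ => hyu.1 l l) (mem_univ j)))
  have hS : ∑ i, y i (τ i) =
      ∑ i, x i (τ i) + (∑ i with τ i = j, c i - ∑ i with τ i = j, x i j) := by
    rw [← sub_eq_iff_eq_add', ← sum_sub_distrib, ← sum_sub_distrib, sum_filter]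
    refine sum_congr rfl fun i _ => ?_
    split_ifs with h
    · rw [h, hyj]
    · rw [hyne _ _ h, sub_self]
  have hle := (div_le_iff₀ hFpos).1 (uStar_div_uStarF_le_pEnvySq hyu hyf)
  have heq := (div_eq_iff hpos.ne').1 hopt
  have := sum_le_uStar y τ
  rw [hF, mul_add] at hle
  linarith

/-- Let `x` be a diagonally envy-free utility matrix with `uStarF x > 0` whose
ratio attains `p_envy(n,n)`, let `τ` be an optimal assignment, and suppose
`τ j = j` for agent `j`. Then `x i j = x j j` for every item `i` with
`τ i = j`. -/
theorem big_agent_constant_on_bundle (n : ℕ) (hn : 1 ≤ n)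
    (x : Fin n → Fin n → ℝ) (hx : IsUtilMatrix n x) (hef : DiagEnvyFree n x)
    (hpos : 0 < uStarF n x)
    (hopt : uStar n x / uStarF n x = pEnvySq n)
    (τ : Fin n → Fin n) (hτ : ∑ i, x i (τ i) = uStar n x)
    (j : Fin n) (hjj : τ j = j) :
    ∀ i : Fin n, τ i = j → x i j = x j j := by
  have hp : 0 < pEnvySq n := hopt ▸ div_pos (hpos.trans_le (sum_le_uStar x id)) hpos
  set B : Finset (Fin n) := {i | τ i = j} with hB
  have hBpos : (0 : ℝ) < #B :=
    Nat.cast_pos.2 (card_pos.2 ⟨j, by simp [hB, hjj]⟩)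
  have hBn : (#B : ℝ) ≤ n := by
    exact_mod_cast (card_le_univ B).trans_eq (Fintype.card_fin n)
  have hm : 1 ≤ n * x j j := by
    simpa [hx.2 j] using sum_le_card_nsmul univ (fun i => x i j) _ fun i _ => hef i j
  have hS : ∑ i ∈ B, x i j ≤ 1 :=
    (sum_le_univ_sum_of_nonneg fun i => hx.1 i j).trans_eq (hx.2 j)
  have key : ∀ v : ℝ, 1 ≤ n * v → #B * v ≤ 1 →
      #B * v - ∑ i ∈ B, x i j ≤ pEnvySq n * (v - x j j) := by
    intro v hv hv'
    obtain ⟨c, hc, hcv, hsum, hcB⟩ := exists_sum_eq_one_eq_on B hv hv'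
    have hcj : c j = v := hcB j (by simp [hB, hjj])
    have h := bundle_sum_sub_le_pEnvySq_mul hx hef hpos hopt hτ j hc
      (fun i => (hcv i).trans_eq hcj.symm) hsum
    rwa [← hB, sum_congr rfl hcB, sum_const, nsmul_eq_mul, hcj] at h
  rcases le_or_gt (#B * x j j) 1 with h | h
  · have hk := key (x j j) hm h
    have heq : ∑ i ∈ B, x i j = ∑ i ∈ B, x j j :=
      le_antisymm (sum_le_sum fun i _ => hef i j) (by
        rw [sum_const, nsmul_eq_mul]
        linarith)
    intro i hi
    exact (sum_eq_sum_iff_of_le fun i _ => hef i j).1 heq i (by simp [hB, hi])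
  · have hk := key (1 / #B) (by rw [mul_one_div]; exact (one_le_div hBpos).2 hBn)
      (mul_one_div_cancel hBpos.ne').le
    rw [mul_one_div_cancel hBpos.ne'] at hk
    have hlt : 1 / #B < x j j := (div_lt_iff₀' hBpos).2 h
    linarith [mul_neg_of_pos_of_neg hp (sub_neg.2 hlt)]
end

section
/- For every diagonally envy-free utility matrix x on n agents and n items there exists a diagonally envy-free utility matrix x' with u*(x')/u*_f(x') ≥ u*(x)/u*_f(x) in which every column has a rigid structure: for each agent j there is an integer k_j with 1 ≤ k_j ≤ n such that exactly k_j of the entries x'(1,j),...,x'(n,j) equal 1/k_j and all other entries of column j equal 0. -/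
open Finset

/-- The uniform probability vector on the finite set `S`. -/
noncomputable def uniformVec {ι : Type*} [DecidableEq ι] (S : Finset ι) (i : ι) : ℝ :=
  if i ∈ S then 1 / (#S : ℝ) else 0

/-- A probability vector whose maximum is attained at `j` is a convex combination of uniform
vectors on sets containing `j`. -/
theorem mem_convexHull_uniformVec {ι : Type*} [Fintype ι] [DecidableEq ι] (j : ι) (c : ι → ℝ)
    (h0 : ∀ i, 0 ≤ c i) (h1 : ∑ i, c i = 1) (hj : ∀ i, c i ≤ c j) :
    c ∈ convexHull ℝ {v : ι → ℝ | ∃ S : Finset ι, j ∈ S ∧ v = uniformVec S} := by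
  induction hk : #{i | 0 < c i} using Nat.strong_induction_on generalizing c with
  | _ k ih =>
  set S : Finset ι := {i | 0 < c i} with hS
  have memS : ∀ i, i ∈ S ↔ 0 < c i := fun i => by simp [hS]
  have zeroS : ∀ i, i ∉ S → c i = 0 := fun i hi =>
    le_antisymm (not_lt.1 fun h => hi ((memS i).2 h)) (h0 i)
  have hjS : j ∈ S := by
    rw [memS]
    by_contra h
    have : ∑ i, c i ≤ 0 := Finset.sum_nonpos fun i _ => (hj i).trans (not_lt.1 h)
    linarith
  have hSsum : ∑ i ∈ S, c i = 1 := by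
    rw [← h1]
    exact Finset.sum_subset (Finset.subset_univ S) fun i _ hi => zeroS i hi
  have hcard : (0 : ℝ) < #S := by exact_mod_cast Finset.card_pos.2 ⟨j, hjS⟩
  obtain ⟨p, hpS, hp⟩ := S.exists_min_image c ⟨j, hjS⟩
  have hpos : 0 < c p := (memS p).1 hpS
  have hle : #S * c p ≤ 1 := by
    rw [← hSsum, ← nsmul_eq_mul]
    exact Finset.card_nsmul_le_sum S c (c p) hp
  have hU : uniformVec S ∈ {v : ι → ℝ | ∃ S : Finset ι, j ∈ S ∧ v = uniformVec S} := ⟨S, hjS, rfl⟩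
  rcases hle.eq_or_lt with heq | hlt
  · have hall : ∀ i ∈ S, c p = c i := by
      refine (Finset.sum_eq_sum_iff_of_le hp).1 ?_
      rw [Finset.sum_const, nsmul_eq_mul, heq, hSsum]
    have : c = uniformVec S := by
      funext i
      unfold uniformVec
      split_ifs with hi
      · rw [← hall i hi, eq_div_iff hcard.ne', mul_comm, heq]
      · exact zeroS i hi
    rw [this]
    exact subset_convexHull ℝ _ hU
  · set t : ℝ := #S * c p with ht
    have ht1 : 0 < 1 - t := by linarith
    set d : ι → ℝ := fun i => (c i - if i ∈ S then c p else 0) / (1 - t) with hd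
    have hd0 : ∀ i, 0 ≤ d i := fun i => by
      refine div_nonneg ?_ ht1.le
      split_ifs with hi
      · linarith [hp i hi]
      · linarith [h0 i]
    have hd1 : ∑ i, d i = 1 := by
      rw [← Finset.sum_div, Finset.sum_sub_distrib, h1, Finset.sum_ite_mem, Finset.univ_inter,
        Finset.sum_const, nsmul_eq_mul]
      exact div_self ht1.ne'
    have hdj : ∀ i, d i ≤ d j := fun i => by
      refine div_le_div_of_nonneg_right ?_ ht1.le
      rw [if_pos hjS]
      split_ifs with hi
      · linarith [hj i]
      · linarith [zeroS i hi, hp j hjS]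
    have hsub : ({i | 0 < d i} : Finset ι) ⊂ S := by
      refine (Finset.ssubset_iff_of_subset fun i hi => ?_).2 ⟨p, hpS, ?_⟩
      · by_contra hiS
        simp [hd, hiS, zeroS i hiS] at hi
      · simp [hd, hpS]
    have hdm := ih _ (hk ▸ Finset.card_lt_card hsub) d hd0 hd1 hdj rfl
    have hc : c = t • uniformVec S + (1 - t) • d := by
      funext i
      simp only [hd, uniformVec, Pi.add_apply, Pi.smul_apply, smul_eq_mul]
      rw [mul_div_cancel₀ _ ht1.ne']
      split_ifs with hi
      · rw [ht]; field_simp; ring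
      · ring
    rw [hc]
    exact convex_convexHull ℝ _ (subset_convexHull ℝ _ hU) hdm (mul_pos hcard hpos).le ht1.le
      (by ring)

/-- For every `r`, the function `uStar - r * uStarF` is convex. -/
theorem convexOn_uStar_sub_mul_uStarF (n : ℕ) (r : ℝ) :
    ConvexOn ℝ Set.univ fun x : Fin n → Fin n → ℝ => uStar n x - r * uStarF n x := by
  refine ⟨convex_univ, fun x _ y _ a b ha hb _ => ?_⟩
  have hF : uStarF n (a • x + b • y) = a * uStarF n x + b * uStarF n y := by
    simp only [uStarF, Pi.add_apply, Pi.smul_apply, smul_eq_mul, Finset.sum_add_distrib,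
      Finset.mul_sum]
  have hS : uStar n (a • x + b • y) ≤ a * uStar n x + b * uStar n y := by
    simp only [uStar, Finset.mul_sum, ← Finset.sum_add_distrib]
    refine Finset.sum_le_sum fun i _ => ?_
    have : Nonempty (Fin n) := ⟨i⟩
    refine ciSup_le fun j => ?_
    simp only [Pi.add_apply, Pi.smul_apply, smul_eq_mul]
    gcongr
    · exact le_ciSup (Set.finite_range (x i)).bddAbove j
    · exact le_ciSup (Set.finite_range (y i)).bddAbove j
  simp only [smul_eq_mul, hF]
  linarith

/-- The matrix `x` with column `j` replaced by `c`. -/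
def replaceCol {n : ℕ} (x : Fin n → Fin n → ℝ) (j : Fin n) (c : Fin n → ℝ) :
    Fin n → Fin n → ℝ :=
  fun i => Function.update (x i) j (c i)

theorem convexOn_replaceCol {n : ℕ} (r : ℝ) (x : Fin n → Fin n → ℝ) (j : Fin n) :
    ConvexOn ℝ Set.univ fun c : Fin n → ℝ =>
      uStar n (replaceCol x j c) - r * uStarF n (replaceCol x j c) := by
  refine ⟨convex_univ, fun c _ d _ a b ha hb hab => ?_⟩
  have h : replaceCol x j (a • c + b • d) = a • replaceCol x j c + b • replaceCol x j d := by
    funext i k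
    by_cases hk : k = j
    · subst hk; simp [replaceCol]
    · simp [replaceCol, hk, ← add_mul, hab]
  simp only [h]
  exact (convexOn_uStar_sub_mul_uStarF n r).2 (Set.mem_univ _) (Set.mem_univ _) ha hb hab

theorem sum_uniformVec {ι : Type*} [Fintype ι] [DecidableEq ι] {S : Finset ι} (hS : S.Nonempty) :
    ∑ i, uniformVec S i = 1 := by
  have : (#S : ℝ) ≠ 0 := by exact_mod_cast hS.card_ne_zero
  simp [uniformVec, this]

theorem uniformVec_nonneg {ι : Type*} [DecidableEq ι] (S : Finset ι) (i : ι) :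
    0 ≤ uniformVec S i := by
  unfold uniformVec
  positivity

theorem uniformVec_le {ι : Type*} [DecidableEq ι] {S : Finset ι} {j : ι} (hj : j ∈ S) (i : ι) :
    uniformVec S i ≤ uniformVec S j := by
  simp only [uniformVec, if_pos hj]
  split_ifs
  · exact le_rfl
  · positivity

/-- The columns in `T` can be made uniform without decreasing `uStar - r * uStarF`. -/
theorem exists_uniform_columns {n : ℕ} (r : ℝ) (x : Fin n → Fin n → ℝ) (hx : IsUtilMatrix n x)
    (hef : DiagEnvyFree n x) (T : Finset (Fin n)) :
    ∃ y : Fin n → Fin n → ℝ, IsUtilMatrix n y ∧ DiagEnvyFree n y ∧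
      uStar n x - r * uStarF n x ≤ uStar n y - r * uStarF n y ∧
      ∀ j ∈ T, ∃ S : Finset (Fin n), j ∈ S ∧ ∀ i, y i j = uniformVec S i := by
  induction T using Finset.induction_on with
  | empty => exact ⟨x, hx, hef, le_rfl, by simp⟩
  | insert j T _ ih =>
  obtain ⟨y, hy, hyef, hle, hT⟩ := ih
  obtain ⟨_, ⟨S, hjS, rfl⟩, hS⟩ := (convexOn_replaceCol r y j).exists_ge_of_mem_convexHull
    (Set.subset_univ _)
    (mem_convexHull_uniformVec j (fun i => y i j) (fun i => hy.1 i j) (hy.2 j) fun i => hyef i j)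
  have hself : replaceCol y j (fun i => y i j) = y := by
    funext i
    exact Function.update_eq_self j (y i)
  rw [hself] at hS
  have hcol : ∀ i, replaceCol y j (uniformVec S) i j = uniformVec S i := fun i => by
    simp [replaceCol]
  have hne : ∀ k, k ≠ j → ∀ i, replaceCol y j (uniformVec S) i k = y i k := fun k hk i => by
    simp [replaceCol, hk]
  refine ⟨replaceCol y j (uniformVec S), ⟨fun i k => ?_, fun k => ?_⟩, fun i k => ?_,
    hle.trans hS, fun k hk => ?_⟩ <;> rcases eq_or_ne k j with rfl | hkj
  · rw [hcol]; exact uniformVec_nonneg S i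
  · rw [hne k hkj]; exact hy.1 i k
  · simp only [hcol]; exact sum_uniformVec ⟨k, hjS⟩
  · simp only [hne k hkj]; exact hy.2 k
  · rw [hcol, hcol]; exact uniformVec_le hjS i
  · rw [hne k hkj, hne k hkj]; exact hyef i k
  · exact ⟨S, hjS, hcol⟩
  · simp only [hne k hkj]
    exact hT k (Finset.mem_of_mem_insert_of_ne hk hkj)

/-- For every diagonally envy-free utility matrix `x` with `uStarF x > 0` there
is a diagonally envy-free utility matrix `x'` with at least as large a ratio in
which every column `j` consists of exactly `k_j` entries equal to `1/k_j`
(for some integer `1 ≤ k_j ≤ n`) and zeros elsewhere. -/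
theorem exists_rigid_structure (n : ℕ) (hn : 1 ≤ n)
    (x : Fin n → Fin n → ℝ) (hx : IsUtilMatrix n x) (hef : DiagEnvyFree n x)
    (hpos : 0 < uStarF n x) :
    ∃ x' : Fin n → Fin n → ℝ, IsUtilMatrix n x' ∧ DiagEnvyFree n x' ∧
      uStar n x' / uStarF n x' ≥ uStar n x / uStarF n x ∧
      ∀ j : Fin n, ∃ k : ℕ, 1 ≤ k ∧ k ≤ n ∧
        ∃ S : Finset (Fin n), S.card = k ∧
          (∀ i ∈ S, x' i j = 1 / k) ∧ (∀ i ∉ S, x' i j = 0) := by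
  obtain ⟨y, hy, hyef, hle, hcol⟩ :=
    exists_uniform_columns (uStar n x / uStarF n x) x hx hef Finset.univ
  refine ⟨y, hy, hyef, ?_, fun j => ?_⟩
  · have hypos : 0 < uStarF n y := by
      refine Finset.sum_pos (fun j _ => ?_) ⟨⟨0, hn⟩, Finset.mem_univ _⟩
      obtain ⟨S, hjS, hS⟩ := hcol j (Finset.mem_univ j)
      have : (0 : ℝ) < #S := by exact_mod_cast Finset.card_pos.2 ⟨j, hjS⟩
      rw [hS, uniformVec, if_pos hjS]
      positivity
    rw [ge_iff_le, le_div_iff₀ hypos]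
    rw [div_mul_cancel₀ _ hpos.ne'] at hle
    linarith
  · obtain ⟨S, hjS, hS⟩ := hcol j (Finset.mem_univ j)
    refine ⟨#S, Finset.card_pos.2 ⟨j, hjS⟩, by simpa using Finset.card_le_univ S, S, rfl,
      fun i hi => ?_, fun i hi => ?_⟩
    · rw [hS, uniformVec, if_pos hi]
    · rw [hS, uniformVec, if_neg hi]
end

section
/- Let n ≥ 1 and set a = k = ⌊√n⌋. Define the utility matrix x on n agents and n items by: for each agent j with 1 ≤ j ≤ a, x(i,j) = 1/k for the k items i in the block {(j−1)k+1, ..., jk} and x(i,j) = 0 for all other items i; and for each agent j with a < j ≤ n, x(i,j) = 1/n for all items i. Then (after permuting items so that the diagonal allocation is envy-free) x is a diagonally envy-free utility matrix and u*(x)/u*_f(x) ≥ a/2 ≥ (1/2)·√n − 1/2. -/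
/-- The sum of a constant over the elements of `Fin n` lying in a half-open interval. -/
lemma sum_fin_indicator_Ico {n a b : ℕ} (hab : a ≤ b) (hb : b ≤ n) (c : ℝ) :
    ∑ i : Fin n, (if a ≤ i.val ∧ i.val < b then c else 0) = ((b : ℝ) - a) * c := by
  rw [Fin.sum_univ_eq_sum_range (fun i => if a ≤ i ∧ i < b then c else 0) n,
    ← Finset.sum_filter]
  have h : (Finset.range n).filter (fun i => a ≤ i ∧ i < b) = Finset.Ico a b := by
    ext i
    simp only [Finset.mem_filter, Finset.mem_range, Finset.mem_Ico]
    omega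
  rw [h, Finset.sum_const, Nat.card_Ico, nsmul_eq_mul, Nat.cast_sub hab]

/-- Some permutation of `Fin n` sends `j` to `j * k` for every `j < k`, when `k * k ≤ n`. -/
lemma exists_perm_val_eq_mul {n k : ℕ} (hk : 0 < k) (hkn : k * k ≤ n) :
    ∃ σ : Equiv.Perm (Fin n), ∀ j : Fin n, j.val < k → (σ j).val = j.val * k := by
  have hlt : ∀ j : Fin n, j.val < k → j.val * k < n := fun j hj =>
    (Nat.mul_lt_mul_of_pos_right hj hk).trans_le hkn
  let f : Fin n → Fin n := fun j => if h : j.val < k then ⟨j.val * k, hlt j h⟩ else j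
  have hf : ∀ j : Fin n, j.val < k → (f j).val = j.val * k := fun j hj => by simp [f, hj]
  obtain ⟨g, hg⟩ := Finset.exists_equiv_extend_of_card_eq
    (t := (Finset.univ : Finset (Fin n))) (s := Finset.univ.filter (fun j : Fin n => j.val < k))
    (f := f) (by simp) (Finset.subset_univ _) (by
      intro i hi j hj hij
      have hi : i.val < k := by simpa using hi
      have hj : j.val < k := by simpa using hj
      have h := congrArg Fin.val hij
      rw [hf i hi, hf j hj] at h
      exact Fin.ext (Nat.eq_of_mul_eq_mul_right hk h))
  refine ⟨g.trans (Equiv.subtypeUnivEquiv Finset.mem_univ), fun j hj => ?_⟩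
  rw [← hf j hj, ← hg j (by simpa using hj)]
  rfl


open Finset

/-- Let `a = k = ⌊√n⌋` and let `x` give each of the first `a` agents utility
`1/k` on its own block of `k` items (zero elsewhere) and the remaining agents
utility `1/n` on every item. Then, after permuting the items so that the
diagonal allocation is envy-free, `x` is a diagonally envy-free utility matrix
with `uStar/uStarF ≥ a/2 ≥ (1/2)·√n − 1/2`. -/
theorem lower_bound_construction (n : ℕ) (hn : 1 ≤ n) :
    ∀ x : Fin n → Fin n → ℝ,
      (x = fun i j =>
        if j.val < Nat.sqrt n then
          (if j.val * Nat.sqrt n ≤ i.val ∧ i.val < (j.val + 1) * Nat.sqrt n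
            then 1 / (Nat.sqrt n : ℝ) else 0)
        else 1 / (n : ℝ)) →
      ∃ σ : Equiv.Perm (Fin n),
        IsUtilMatrix n (fun i j => x (σ i) j) ∧
        DiagEnvyFree n (fun i j => x (σ i) j) ∧
        uStar n (fun i j => x (σ i) j) / uStarF n (fun i j => x (σ i) j)
          ≥ (Nat.sqrt n : ℝ) / 2 ∧
        (Nat.sqrt n : ℝ) / 2 ≥ (1 / 2) * Real.sqrt n - 1 / 2 := by
  intro x hx
  set k := Nat.sqrt n with hk
  have hk0 : 0 < k := Nat.sqrt_pos.2 hn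
  have hkn : k * k ≤ n := Nat.sqrt_le n
  have hkR : (0 : ℝ) < k := by exact_mod_cast hk0
  have hnR : (0 : ℝ) < n := by exact_mod_cast hn
  have hle_n : k ≤ n := Nat.sqrt_le_self n
  have hblock : ∀ i j : Fin n, j.val < k → x i j =
      if j.val * k ≤ i.val ∧ i.val < (j.val + 1) * k then 1 / (k : ℝ) else 0 := by
    intro i j hj
    simp [hx, hj]
  have hunif : ∀ i j : Fin n, ¬ j.val < k → x i j = 1 / (n : ℝ) := by
    intro i j hj
    simp [hx, hj]
  have hnonneg : ∀ i j, 0 ≤ x i j := by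
    intro i j
    rw [hx]
    dsimp only
    split_ifs <;> positivity
  obtain ⟨σ, hσ⟩ := exists_perm_val_eq_mul hk0 hkn
  have hdiag : ∀ j : Fin n, j.val < k → x (σ j) j = 1 / (k : ℝ) := by
    intro j hj
    rw [hblock _ _ hj, if_pos]
    rw [hσ j hj]
    exact ⟨le_rfl, Nat.mul_lt_mul_of_pos_right j.val.lt_succ_self hk0⟩
  refine ⟨σ, ⟨fun i j => hnonneg _ _, fun j => ?_⟩, fun i j => ?_, ?_, ?_⟩
  · rw [Equiv.sum_comp σ (fun i => x i j)]
    by_cases hj : j.val < k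
    · simp_rw [hblock _ j hj]
      rw [sum_fin_indicator_Ico (Nat.mul_le_mul_right k j.val.le_succ)
        ((Nat.mul_le_mul_right k hj).trans hkn)]
      push_cast
      field_simp
      ring
    · simp_rw [hunif _ j hj]
      simp [hnR.ne']
  · by_cases hj : j.val < k
    · dsimp only
      rw [hdiag j hj, hblock _ j hj]
      split_ifs
      · exact le_rfl
      · positivity
    · dsimp only
      rw [hunif _ j hj, hunif _ j hj]
  · have hopt : (k : ℝ) ≤ uStar n (fun i j => x (σ i) j) := by
      unfold uStar
      rw [Equiv.sum_comp σ (fun i => ⨆ j, x i j)]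
      calc (k : ℝ) = ∑ i : Fin n, (if 0 ≤ i.val ∧ i.val < k * k then 1 / (k : ℝ) else 0) := by
            rw [sum_fin_indicator_Ico (Nat.zero_le _) hkn]
            push_cast
            field_simp
            ring
        _ ≤ _ := Finset.sum_le_sum fun i _ => by
            split_ifs with h
            · have hq : i.val / k < k := Nat.div_lt_of_lt_mul h.2
              refine le_trans (le_of_eq ?_) (le_ciSup (f := fun j => x i j)
                (Set.finite_range _).bddAbove ⟨i.val / k, hq.trans_le hle_n⟩)
              rw [hblock _ _ hq, if_pos]
              exact ⟨Nat.div_mul_le_self _ _, by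
                rw [mul_comm]; exact Nat.lt_mul_div_succ _ hk0⟩
            · exact Real.iSup_nonneg fun j => hnonneg i j
    have hef : uStarF n (fun i j => x (σ i) j) ≤ 2 := by
      unfold uStarF
      calc ∑ j, x (σ j) j
          ≤ ∑ j : Fin n, ((if 0 ≤ j.val ∧ j.val < k then 1 / (k : ℝ) else 0) + 1 / (n : ℝ)) :=
            Finset.sum_le_sum fun j _ => by
              by_cases hj : j.val < k
              · rw [hdiag j hj, if_pos ⟨Nat.zero_le _, hj⟩]
                have : 0 ≤ 1 / (n : ℝ) := by positivity
                linarith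
              · rw [hunif _ j hj, if_neg fun h => hj h.2, zero_add]
        _ = 2 := by
            rw [Finset.sum_add_distrib, sum_fin_indicator_Ico (Nat.zero_le _) hle_n]
            simp [hnR.ne', hkR.ne']
            norm_num
    have hpos : 0 < uStarF n (fun i j => x (σ i) j) := by
      unfold uStarF
      refine Finset.sum_pos' (fun j _ => hnonneg _ _) ⟨⟨0, hn⟩, Finset.mem_univ _, ?_⟩
      dsimp only
      rw [hdiag ⟨0, hn⟩ hk0]
      positivity
    rw [ge_iff_le, le_div_iff₀ hpos]
    nlinarith
  · have h := Real.real_sqrt_le_nat_sqrt_succ (a := n)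
    rw [← hk] at h
    linarith
end

section
/- For n = 3 agents and m = 3 items, the price of envy-freeness equals exactly p_envy(3,3) = 8/7. -/
open Finset

theorem ciSup_fin_three (g : Fin 3 → ℝ) : ⨆ j, g j = max (max (g 0) (g 1)) (g 2) := by
  apply le_antisymm
  · refine ciSup_le fun j => ?_
    fin_cases j <;> simp
  · have h : ∀ j, g j ≤ ⨆ j, g j := le_ciSup (Set.finite_range g).bddAbove
    exact max_le (max_le (h 0) (h 1)) (h 2)

/-- The optimal welfare is attained by some assignment of items to agents. -/
theorem exists_uStar_eq_sum {n : ℕ} [NeZero n] (x : Fin n → Fin n → ℝ) :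
    ∃ f : Fin n → Fin n, uStar n x = ∑ i, x i (f i) := by
  choose f hf using fun i => exists_eq_ciSup_of_finite (f := x i)
  exact ⟨f, by simp only [uStar, hf]⟩

/-- For three agents, every assignment of items has welfare at most `8/7` times that of an
envy-free diagonal allocation. -/
theorem sum_le_mul_uStarF {x : Fin 3 → Fin 3 → ℝ} (hx : IsUtilMatrix 3 x)
    (hd : DiagEnvyFree 3 x) (f : Fin 3 → Fin 3) :
    ∑ i, x i (f i) ≤ 8 / 7 * uStarF 3 x := by
  obtain ⟨hn, hs⟩ := hx
  have hd' : ∀ i j, x i j ≤ x j j := hd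
  simp only [Fin.forall_fin_succ, Fin.sum_univ_three, IsEmpty.forall_iff, and_true,
    Fin.succ_zero_eq_one, Fin.succ_one_eq_two] at hn hs hd'
  simp only [uStarF, Fin.sum_univ_three]
  generalize f 0 = a
  generalize f 1 = b
  generalize f 2 = c
  obtain ⟨_, _, _⟩ := hs
  obtain ⟨⟨_, _, _⟩, ⟨_, _, _⟩, _, _, _⟩ := hn
  obtain ⟨⟨_, _, _⟩, ⟨_, _, _⟩, _, _, _⟩ := hd'
  fin_cases a <;> fin_cases b <;> fin_cases c <;> dsimp <;> linarith

/-- For `n = 3` agents and `m = 3` items, the price of envy-freeness equals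
exactly `8/7`. -/
theorem pEnvySq_three : pEnvySq 3 = 8 / 7 := by
  refine IsGreatest.csSup_eq ⟨?_, ?_⟩
  · refine ⟨![![1 / 2, 1 / 3, 1 / 3], ![1 / 2, 1 / 3, 1 / 3], ![0, 1 / 3, 1 / 3]],
      ⟨?_, ?_⟩, ?_, ?_⟩
    · intro i j
      fin_cases i <;> fin_cases j <;> norm_num
    · intro j
      fin_cases j <;> simp [Fin.sum_univ_three] <;> norm_num
    · intro i j
      fin_cases i <;> fin_cases j <;> norm_num
    · simp only [uStar, uStarF, Fin.sum_univ_three, ciSup_fin_three, Matrix.cons_val]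
      norm_num
  · rintro r ⟨x, hx, hd, rfl⟩
    have hpos : 0 < uStarF 3 x := by
      have h0 := hx.2 0
      simp only [Fin.sum_univ_three] at h0
      have h1 := hx.1 1 1
      have h2 := hx.1 2 2
      have h10 := hd 1 0
      have h20 := hd 2 0
      simp only [uStarF, Fin.sum_univ_three]
      linarith
    obtain ⟨f, hf⟩ := exists_uStar_eq_sum (n := 3) x
    rw [div_le_iff₀ hpos, hf]
    exact sum_le_mul_uStarF hx hd f
end

section
/- For n = 4 agents and m = 4 items, the price of envy-freeness equals exactly p_envy(4,4) = 4/3. -/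
open Finset

/-- In a diagonally envy-free matrix, the diagonal entry of each agent is at least `1 / n`. -/
lemma DiagEnvyFree.one_le_mul {n : ℕ} {x : Fin n → Fin n → ℝ} (hx : IsUtilMatrix n x)
    (hd : DiagEnvyFree n x) (j : Fin n) : 1 ≤ n * x j j := by
  rw [← hx.2 j]
  simpa using sum_le_card_nsmul univ (fun i => x i j) (x j j) fun i _ => hd i j

/-- For four agents, the value of a bundle `S` to agent `j` is bounded in terms of the size of `S`
and the utility of `j` for their own item. -/
lemma three_mul_sum_le {x : Fin 4 → Fin 4 → ℝ} (hx : IsUtilMatrix 4 x)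
    (hd : DiagEnvyFree 4 x) (j : Fin 4) (S : Finset (Fin 4)) :
    3 * ∑ i ∈ S, x i j ≤ 4 * x j j + #S - 1 := by
  have hcard : ∑ i ∈ S, x i j ≤ #S * x j j := by
    simpa using sum_le_card_nsmul S (fun i => x i j) (x j j) fun i _ => hd i j
  have hone : ∑ i ∈ S, x i j ≤ 1 := by
    rw [← hx.2 j]
    exact sum_le_sum_of_subset_of_nonneg (subset_univ S) fun i _ _ => hx.1 i j
  have hdiag : 1 ≤ 4 * x j j := by simpa using hd.one_le_mul hx j
  rcases le_or_gt 3 #S with h | h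
  · have : (3 : ℝ) ≤ #S := by exact_mod_cast h
    linarith
  · interval_cases #S <;> norm_num at hcard ⊢ <;> linarith

/-- For four agents, the optimal welfare is at most `4 / 3` of the envy-free welfare. -/
lemma three_mul_uStar_le {x : Fin 4 → Fin 4 → ℝ} (hx : IsUtilMatrix 4 x)
    (hd : DiagEnvyFree 4 x) : 3 * uStar 4 x ≤ 4 * uStarF 4 x := by
  choose f hf using fun i => exists_eq_ciSup_of_finite (f := x i)
  have hfib : uStar 4 x = ∑ j, ∑ i with f i = j, x i j := by
    rw [uStar, ← sum_fiberwise univ f]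
    refine sum_congr rfl fun j _ => sum_congr rfl fun i hi => ?_
    rw [← hf i, (mem_filter.mp hi).2]
  have hcard : ∑ j, (#{i | f i = j} : ℝ) = 4 := by
    exact_mod_cast (card_eq_sum_card_fiberwise (s := univ) (t := univ) (f := f) (by simp)).symm
  calc 3 * uStar 4 x = ∑ j, 3 * ∑ i with f i = j, x i j := by rw [hfib, mul_sum]
    _ ≤ ∑ j, (4 * x j j + #{i | f i = j} - 1) :=
      sum_le_sum fun j _ => three_mul_sum_le hx hd j _
    _ = 4 * uStarF 4 x := by
      rw [sum_sub_distrib, sum_add_distrib, hcard, ← mul_sum]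
      simp [uStarF]

/-- Agents `0` and `1` split their utility between items `0, 2` and `1, 3` respectively, while
agents `2` and `3` are indifferent between all items. -/
noncomputable def extremalMatrix : Fin 4 → Fin 4 → ℝ :=
  ![![1/2, 0, 1/4, 1/4], ![0, 1/2, 1/4, 1/4], ![1/2, 0, 1/4, 1/4], ![0, 1/2, 1/4, 1/4]]

lemma isUtilMatrix_extremalMatrix : IsUtilMatrix 4 extremalMatrix := by
  refine ⟨fun i j => ?_, fun j => ?_⟩
  · fin_cases i <;> fin_cases j <;> norm_num [extremalMatrix]
  · rw [Fin.sum_univ_four]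
    fin_cases j <;> simp [extremalMatrix] <;> norm_num

lemma diagEnvyFree_extremalMatrix : DiagEnvyFree 4 extremalMatrix := by
  intro i j
  fin_cases i <;> fin_cases j <;> norm_num [extremalMatrix]

lemma uStarF_extremalMatrix : uStarF 4 extremalMatrix = 3 / 2 := by
  rw [uStarF, Fin.sum_univ_four]
  simp [extremalMatrix]
  norm_num

lemma two_le_uStar_extremalMatrix : 2 ≤ uStar 4 extremalMatrix := by
  have h (i j : Fin 4) : extremalMatrix i j ≤ ⨆ k, extremalMatrix i k :=
    le_ciSup (Set.finite_range _).bddAbove j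
  have h0 := h 0 0
  have h1 := h 1 1
  have h2 := h 2 0
  have h3 := h 3 1
  have e : extremalMatrix 0 0 = 1/2 ∧ extremalMatrix 1 1 = 1/2 ∧
      extremalMatrix 2 0 = 1/2 ∧ extremalMatrix 3 1 = 1/2 := by simp [extremalMatrix]
  rw [uStar, Fin.sum_univ_four]
  linarith

/-- For `n = 4` agents and `m = 4` items, the price of envy-freeness equals
exactly `4/3`. -/
theorem pEnvySq_four : pEnvySq 4 = 4 / 3 := by
  refine IsGreatest.csSup_eq ⟨⟨extremalMatrix, isUtilMatrix_extremalMatrix,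
    diagEnvyFree_extremalMatrix, ?_⟩, ?_⟩
  · have hle := three_mul_uStar_le isUtilMatrix_extremalMatrix diagEnvyFree_extremalMatrix
    have hge := two_le_uStar_extremalMatrix
    rw [uStarF_extremalMatrix] at hle ⊢
    rw [show uStar 4 extremalMatrix = 2 by linarith]
    norm_num
  · rintro r ⟨x, hx, hd, rfl⟩
    have hpos : 0 < uStarF 4 x := by
      refine sum_pos (fun j _ => ?_) univ_nonempty
      exact pos_of_mul_pos_right (zero_lt_one.trans_le (hd.one_le_mul hx j)) (Nat.cast_nonneg _)
    rw [div_le_div_iff₀ hpos three_pos]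
    linarith [three_mul_uStar_le hx hd]
end
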